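/- For all functions f, g : {0,1}^n → ℝ and all ρ ∈ [0,1], ⟨g, T_ρ f⟩ ≤ ‖g‖₂ · ‖f‖_{1+ρ²}, where the inner product and norms are with respect to the uniform distribution on {0,1}^n. -/

import Mathlib

/-- The probability that the noise channel `N_ρ` maps `x` to `y`: each bit of `x` is kept
with probability `(1+ρ)/2` and flipped with probability `(1-ρ)/2`. -/
noncomputable def noiseK (ρ : ℝ) {n : ℕ} (x y : Fin n → Bool) : ℝ :=
  ∏ i, if y i = x i then (1 + ρ) / 2 else (1 - ρ) / 2

/-- The noise operator `T_ρ`: `(T_ρ f)(x) = E_{y ← N_ρ(x)}[f(y)]`. -/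
noncomputable def Tnoise (ρ : ℝ) {n : ℕ} (f : (Fin n → Bool) → ℝ) (x : Fin n → Bool) : ℝ :=
  ∑ y, noiseK ρ x y * f y

/-- The `ℓ`-norm of `f : {0,1}^n → ℝ` with respect to the uniform distribution:
`‖f‖_ℓ = (E_x[|f(x)|^ℓ])^{1/ℓ}`. -/
noncomputable def pnorm {n : ℕ} (l : ℝ) (f : (Fin n → Bool) → ℝ) : ℝ :=
  ((2 ^ n : ℝ)⁻¹ * ∑ x, |f x| ^ l) ^ (1 / l)

theorem two_mul_le_one_add_rpow_sub_one_sub_rpow {q b : ℝ} (hq0 : 0 ≤ q) (hq1 : q ≤ 1)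
    (hb0 : 0 ≤ b) (hb1 : b ≤ 1) : 2 * q * b ≤ (1 + b) ^ q - (1 - b) ^ q := by
  have hmono : MonotoneOn (fun x : ℝ => (1 + x) ^ q - (1 - x) ^ q - 2 * q * x)
      (Set.Icc 0 1) := by
    have hderiv : ∀ x ∈ interior (Set.Icc (0 : ℝ) 1),
        HasDerivWithinAt (fun x : ℝ => (1 + x) ^ q - (1 - x) ^ q - 2 * q * x)
          (q * ((1 + x) ^ (q - 1) + (1 - x) ^ (q - 1) - 2)) (interior (Set.Icc (0 : ℝ) 1)) x := by
      intro x hx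
      rw [interior_Icc] at hx
      have h1 := ((hasDerivAt_id x).const_add 1).rpow_const (p := q)
        (Or.inl (by simp only [id]; linarith [hx.1]))
      have h2 := ((hasDerivAt_id x).const_sub 1).rpow_const (p := q)
        (Or.inl (by simp only [id]; linarith [hx.2]))
      have h3 := (h1.sub h2).sub ((hasDerivAt_id x).const_mul (2 * q))
      refine (h3.congr_deriv ?_).hasDerivWithinAt
      simp only [id]
      ring
    refine monotoneOn_of_hasDerivWithinAt_nonneg (convex_Icc 0 1) ?_ hderiv ?_
    · refine Continuous.continuousOn (((Continuous.rpow_const (by fun_prop) ?_).sub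
        (Continuous.rpow_const (by fun_prop) ?_)).sub (by fun_prop))
      · exact fun _ => Or.inr hq0
      · exact fun _ => Or.inr hq0
    · intro x hx
      rw [interior_Icc] at hx
      have hx1 : 0 < 1 - x := by linarith [hx.2]
      have hx2 : 0 < 1 + x := by linarith [hx.1]
      have hprod : 1 ≤ (1 + x) ^ (q - 1) * (1 - x) ^ (q - 1) := by
        rw [← Real.mul_rpow hx2.le hx1.le]
        exact Real.one_le_rpow_of_pos_of_le_one_of_nonpos (mul_pos hx2 hx1)
          (by nlinarith [sq_nonneg x]) (by linarith)
      have hs1 := Real.rpow_pos_of_pos hx2 (q - 1)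
      have hs2 := Real.rpow_pos_of_pos hx1 (q - 1)
      refine mul_nonneg hq0 ?_
      nlinarith [sq_nonneg ((1 + x) ^ (q - 1) - (1 - x) ^ (q - 1))]
  have h := hmono (Set.left_mem_Icc.2 zero_le_one) ⟨hb0, hb1⟩ hb0
  simp only [add_zero, sub_zero, mul_zero, Real.one_rpow, sub_self] at h
  linarith

theorem two_add_mul_sq_le_rpow_add_rpow {p b : ℝ} (hp1 : 1 ≤ p) (hp2 : p ≤ 2)
    (hb : |b| ≤ 1) : 2 + p * (p - 1) * b ^ 2 ≤ (1 + b) ^ p + (1 - b) ^ p := by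
  wlog hb0 : 0 ≤ b generalizing b
  · have h := this (b := -b) (by rwa [abs_neg]) (by linarith)
    simp only [neg_sq, sub_neg_eq_add, ← sub_eq_add_neg] at h
    linarith
  have hb1 : b ≤ 1 := (le_abs_self b).trans hb
  have hmono : MonotoneOn (fun x : ℝ => (1 + x) ^ p + (1 - x) ^ p - p * (p - 1) * x ^ 2)
      (Set.Icc 0 1) := by
    have hderiv : ∀ x ∈ interior (Set.Icc (0 : ℝ) 1),
        HasDerivWithinAt (fun x : ℝ => (1 + x) ^ p + (1 - x) ^ p - p * (p - 1) * x ^ 2)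
          (p * ((1 + x) ^ (p - 1) - (1 - x) ^ (p - 1) - 2 * (p - 1) * x))
          (interior (Set.Icc (0 : ℝ) 1)) x := by
      intro x _
      have h1 := ((hasDerivAt_id x).const_add 1).rpow_const (p := p) (Or.inr hp1)
      have h2 := ((hasDerivAt_id x).const_sub 1).rpow_const (p := p) (Or.inr hp1)
      have h3 := (h1.add h2).sub (((hasDerivAt_id x).pow 2).const_mul (p * (p - 1)))
      refine (h3.congr_deriv ?_).hasDerivWithinAt
      simp only [id]
      push_cast
      ring
    refine monotoneOn_of_hasDerivWithinAt_nonneg (convex_Icc 0 1) ?_ hderiv ?_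
    · refine Continuous.continuousOn (((Continuous.rpow_const (by fun_prop) ?_).add
        (Continuous.rpow_const (by fun_prop) ?_)).sub (by fun_prop))
      · exact fun _ => Or.inr (by linarith)
      · exact fun _ => Or.inr (by linarith)
    · intro x hx
      rw [interior_Icc] at hx
      have := two_mul_le_one_add_rpow_sub_one_sub_rpow (q := p - 1) (by linarith)
        (by linarith) hx.1.le hx.2.le
      exact mul_nonneg (by linarith) (by linarith)
  have h := hmono (Set.left_mem_Icc.2 zero_le_one) ⟨hb0, hb1⟩ hb0
  norm_num at h
  linarith

theorem one_add_mul_sq_rpow_half_le {p b : ℝ} (hp1 : 1 ≤ p) (hp2 : p ≤ 2) (hb : |b| ≤ 1) :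
    (1 + (p - 1) * b ^ 2) ^ (p / 2) ≤ ((1 + b) ^ p + (1 - b) ^ p) / 2 := by
  have h0 : 0 ≤ (p - 1) * b ^ 2 := mul_nonneg (by linarith) (sq_nonneg b)
  have h1 := rpow_one_add_le_one_add_mul_self (s := (p - 1) * b ^ 2) (by linarith)
    (p := p / 2) (by linarith) (by linarith)
  have h2 := two_add_mul_sq_le_rpow_add_rpow hp1 hp2 hb
  linarith

/-- The two-point hypercontractive inequality, from `L^p` to `L^2`, for nonnegative functions. -/
theorem sqrt_two_point_le {p u v : ℝ} (hp1 : 1 ≤ p) (hp2 : p ≤ 2) (hu : 0 ≤ u) (hv : 0 ≤ v) :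
    √(((u + v) / 2) ^ 2 + (p - 1) * ((u - v) / 2) ^ 2) ≤ ((u ^ p + v ^ p) / 2) ^ (1 / p) := by
  have hp0 : 0 < p := by linarith
  rcases (add_nonneg hu hv).eq_or_lt with h | h
  · obtain rfl : u = 0 := by linarith
    obtain rfl : v = 0 := by linarith
    simp [Real.zero_rpow hp0.ne', Real.rpow_nonneg]
  set a := (u + v) / 2 with ha
  have ha0 : 0 < a := by positivity
  set b := (u - v) / (u + v) with hb
  have hb1 : |b| ≤ 1 := by
    rw [hb, abs_div, abs_of_pos h, div_le_one h, abs_le]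
    constructor <;> linarith
  have hu' : u = a * (1 + b) := by rw [ha, hb]; field_simp; ring
  have hv' : v = a * (1 - b) := by rw [ha, hb]; field_simp; ring
  have hb2 := abs_le.1 hb1
  have hX : 0 ≤ 1 + (p - 1) * b ^ 2 := by
    have : 0 ≤ (p - 1) * b ^ 2 := mul_nonneg (by linarith) (sq_nonneg b)
    linarith
  have hL : a ^ 2 + (p - 1) * ((u - v) / 2) ^ 2 = a ^ 2 * (1 + (p - 1) * b ^ 2) := by
    have : (u - v) / 2 = a * b := by linarith
    rw [this]; ring
  have hR : (u ^ p + v ^ p) / 2 = a ^ p * (((1 + b) ^ p + (1 - b) ^ p) / 2) := by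
    rw [hu', hv', Real.mul_rpow ha0.le (by linarith), Real.mul_rpow ha0.le (by linarith)]
    ring
  have hk := one_add_mul_sq_rpow_half_le hp1 hp2 hb1
  have hY : 0 ≤ ((1 + b) ^ p + (1 - b) ^ p) / 2 := (Real.rpow_nonneg hX _).trans hk
  rw [hL, hR, Real.sqrt_mul (sq_nonneg a), Real.sqrt_sq ha0.le,
    Real.mul_rpow (Real.rpow_nonneg ha0.le _) hY, one_div, Real.rpow_rpow_inv ha0.le hp0.ne']
  refine mul_le_mul_of_nonneg_left ?_ ha0.le
  rw [Real.le_rpow_inv_iff_of_pos (Real.sqrt_nonneg _) hY hp0, Real.sqrt_eq_rpow,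
    ← Real.rpow_mul hX]
  convert hk using 2
  ring

theorem two_point_inner_le {ρ u v s t : ℝ} (hρ : ρ ∈ Set.Icc (0 : ℝ) 1) (hu : 0 ≤ u)
    (hv : 0 ≤ v) :
    (s * ((1 + ρ) / 2 * u + (1 - ρ) / 2 * v) + t * ((1 + ρ) / 2 * v + (1 - ρ) / 2 * u)) / 2 ≤
      ((s ^ (2 : ℝ) + t ^ (2 : ℝ)) / 2) ^ (1 / (2 : ℝ)) *
        ((u ^ (1 + ρ ^ 2) + v ^ (1 + ρ ^ 2)) / 2) ^ (1 / (1 + ρ ^ 2)) := by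
  have h := sqrt_two_point_le (p := 1 + ρ ^ 2) (by nlinarith [sq_nonneg ρ])
    (by nlinarith [hρ.1, hρ.2]) hu hv
  rw [Real.rpow_two, Real.rpow_two]
  refine le_trans ?_ (mul_le_mul_of_nonneg_left h (by positivity))
  rw [← Real.sqrt_eq_rpow, ← Real.sqrt_mul (by positivity)]
  apply Real.le_sqrt_of_sq_le
  have := sq_nonneg (s * ((1 + ρ) / 2 * v + (1 - ρ) / 2 * u) -
    t * ((1 + ρ) / 2 * u + (1 - ρ) / 2 * v))
  nlinarith

theorem sum_bool_cube_succ {n : ℕ} (F : (Fin (n + 1) → Bool) → ℝ) :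
    ∑ x, F x = (∑ x : Fin n → Bool, F (Fin.cons true x)) +
      ∑ x : Fin n → Bool, F (Fin.cons false x) := by
  rw [← (Fin.consEquiv (fun _ : Fin (n + 1) => Bool)).sum_comp, Fintype.sum_prod_type,
    Fintype.sum_bool]
  rfl

theorem noiseK_cons (ρ : ℝ) {n : ℕ} (b c : Bool) (x y : Fin n → Bool) :
    noiseK ρ (Fin.cons b x : Fin (n + 1) → Bool) (Fin.cons c y) =
      (if c = b then (1 + ρ) / 2 else (1 - ρ) / 2) * noiseK ρ x y := by
  simp [noiseK, Fin.prod_univ_succ]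

theorem Tnoise_cons (ρ : ℝ) {n : ℕ} (f : (Fin (n + 1) → Bool) → ℝ) (b : Bool)
    (x : Fin n → Bool) :
    Tnoise ρ f (Fin.cons b x) =
      (1 + ρ) / 2 * Tnoise ρ (fun y => f (Fin.cons b y)) x +
        (1 - ρ) / 2 * Tnoise ρ (fun y => f (Fin.cons (!b) y)) x := by
  cases b <;>
    simp [Tnoise, sum_bool_cube_succ, noiseK_cons, Finset.mul_sum, mul_assoc, add_comm]

theorem pnorm_nonneg {n : ℕ} (l : ℝ) (f : (Fin n → Bool) → ℝ) : 0 ≤ pnorm l f := by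
  unfold pnorm
  positivity

theorem pnorm_rpow {n : ℕ} {l : ℝ} (hl : l ≠ 0) (f : (Fin n → Bool) → ℝ) :
    pnorm l f ^ l = (2 ^ n : ℝ)⁻¹ * ∑ x, |f x| ^ l := by
  unfold pnorm
  rw [one_div, Real.rpow_inv_rpow (by positivity) hl]

theorem pnorm_succ {n : ℕ} {l : ℝ} (hl : l ≠ 0) (f : (Fin (n + 1) → Bool) → ℝ) :
    pnorm l f = ((pnorm l (fun x : Fin n → Bool => f (Fin.cons true x)) ^ l +
      pnorm l (fun x : Fin n → Bool => f (Fin.cons false x)) ^ l) / 2) ^ (1 / l) := by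
  rw [pnorm_rpow hl, pnorm_rpow hl, pnorm, sum_bool_cube_succ]
  congr 1
  rw [pow_succ, mul_inv]
  ring

/-- For all functions `f, g : {0,1}^n → ℝ` and all `ρ ∈ [0,1]`,
`⟨g, T_ρ f⟩ ≤ ‖g‖₂ · ‖f‖_{1+ρ²}`, where `⟨g, h⟩ = E_x[g(x)·h(x)]` over uniform `x`. -/
theorem inner_Tnoise_le {n : ℕ} (f g : (Fin n → Bool) → ℝ)
    (ρ : ℝ) (hρ : ρ ∈ Set.Icc (0 : ℝ) 1) :
    (2 ^ n : ℝ)⁻¹ * ∑ x, g x * Tnoise ρ f x ≤ pnorm 2 g * pnorm (1 + ρ ^ 2) f := by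
  have hp : (1 + ρ ^ 2 : ℝ) ≠ 0 := by positivity
  induction n with
  | zero =>
    have hT : ∀ x, Tnoise ρ f x = f x := by
      intro x
      simp [Tnoise, noiseK, Subsingleton.elim x default]
      exact congrArg f (Subsingleton.elim _ _)
    simp only [hT, pnorm, Fintype.sum_unique, pow_zero, inv_one, one_mul, one_div]
    rw [Real.rpow_rpow_inv (abs_nonneg _) two_ne_zero, Real.rpow_rpow_inv (abs_nonneg _) hp,
      ← abs_mul]
    exact le_abs_self _
  | succ n ih =>
    let F : Bool → (Fin n → Bool) → ℝ := fun b x => f (Fin.cons b x)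
    let G : Bool → (Fin n → Bool) → ℝ := fun b x => g (Fin.cons b x)
    have hρ0 : 0 ≤ (1 + ρ) / 2 := by linarith [hρ.1]
    have hρ1 : 0 ≤ (1 - ρ) / 2 := by linarith [hρ.2]
    have key := two_point_inner_le (s := pnorm 2 (G true)) (t := pnorm 2 (G false)) hρ
      (pnorm_nonneg (1 + ρ ^ 2) (F true)) (pnorm_nonneg (1 + ρ ^ 2) (F false))
    rw [pnorm_succ two_ne_zero g, pnorm_succ hp f]
    refine le_trans ?_ key
    have hsplit : (2 ^ (n + 1) : ℝ)⁻¹ * ∑ x, g x * Tnoise ρ f x =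
        ((1 + ρ) / 2 * ((2 ^ n : ℝ)⁻¹ * ∑ x, G true x * Tnoise ρ (F true) x) +
          (1 - ρ) / 2 * ((2 ^ n : ℝ)⁻¹ * ∑ x, G true x * Tnoise ρ (F false) x) +
          (1 + ρ) / 2 * ((2 ^ n : ℝ)⁻¹ * ∑ x, G false x * Tnoise ρ (F false) x) +
          (1 - ρ) / 2 * ((2 ^ n : ℝ)⁻¹ * ∑ x, G false x * Tnoise ρ (F true) x)) / 2 := by
      simp only [sum_bool_cube_succ, Tnoise_cons, mul_add, Finset.sum_add_distrib,
        mul_left_comm (g _), ← Finset.mul_sum, Bool.not_true, Bool.not_false, F, G]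
      rw [pow_succ, mul_inv]
      ring
    rw [hsplit]
    have h1 := mul_le_mul_of_nonneg_left (ih (F true) (G true)) hρ0
    have h2 := mul_le_mul_of_nonneg_left (ih (F false) (G true)) hρ1
    have h3 := mul_le_mul_of_nonneg_left (ih (F false) (G false)) hρ0
    have h4 := mul_le_mul_of_nonneg_left (ih (F true) (G false)) hρ1
    linarith
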